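/- Let π = w₁·N(a₁, I_d) + w₂·N(a₂, I_d) and π̃ = w̃₁·N(a₁, I_d) + w̃₂·N(a₂, I_d) be mixtures of Gaussians with w₁+w₂ = w̃₁+w̃₂ = 1 and all weights positive. Then KL(π‖π̃) ≥ w₁(log w₁ − log(w̃₁ + exp(−‖a₁−a₂‖²/4))) + w₂(log w₂ − log(w̃₂ + exp(−‖a₁−a₂‖²/4))) − (log 4 + d)·exp((d/2)·log 2 − ‖a₁−a₂‖²/64). -/

import Mathlib

open MeasureTheory

/-- The Gaussian density `N(a, I_d)` at `x`. -/
noncomputable def gaussDensity {d : ℕ} (a x : EuclideanSpace ℝ (Fin d)) : ℝ :=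
  (2 * Real.pi) ^ (-(d : ℝ) / 2) * Real.exp (-‖x - a‖ ^ 2 / 2)

theorem gaussDensity_pos {d : ℕ} (a x : EuclideanSpace ℝ (Fin d)) : 0 < gaussDensity a x := by
  unfold gaussDensity
  positivity

theorem continuous_gaussDensity {d : ℕ} (a : EuclideanSpace ℝ (Fin d)) :
    Continuous (gaussDensity a) := by
  unfold gaussDensity
  fun_prop

theorem integral_gaussDensity {d : ℕ} (a : EuclideanSpace ℝ (Fin d)) :
    ∫ x, gaussDensity a x = 1 := by
  unfold gaussDensity
  rw [integral_const_mul,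
    integral_sub_right_eq_self (fun x : EuclideanSpace ℝ (Fin d) => Real.exp (-‖x‖ ^ 2 / 2)) a]
  have h := GaussianFourier.integral_rexp_neg_mul_sq_norm (V := EuclideanSpace ℝ (Fin d))
    (b := 1 / 2) (by norm_num)
  have h2 : ∀ x : EuclideanSpace ℝ (Fin d), -‖x‖ ^ 2 / 2 = -(1 / 2) * ‖x‖ ^ 2 := fun x => by ring
  simp_rw [h2]
  rw [h, finrank_euclideanSpace_fin, show Real.pi / (1 / 2) = 2 * Real.pi by ring,
    ← Real.rpow_add (by positivity), neg_div, neg_add_cancel, Real.rpow_zero]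

theorem integrable_gaussDensity {d : ℕ} (a : EuclideanSpace ℝ (Fin d)) :
    Integrable (gaussDensity a) :=
  .of_integral_ne_zero (by simp [integral_gaussDensity])

/-- The likelihood ratio of two unit-covariance Gaussians. -/
theorem gaussDensity_eq_mul_exp {d : ℕ} (a b x : EuclideanSpace ℝ (Fin d)) :
    gaussDensity b x =
      gaussDensity a x * Real.exp ((‖x - a‖ ^ 2 - ‖x - b‖ ^ 2) / 2) := by
  unfold gaussDensity
  rw [mul_assoc, ← Real.exp_add]
  ring_nf

/-- Exponential tilting of a Gaussian yields a multiple of a Gaussian with shifted mean. -/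
theorem gaussDensity_mul_exp_mul {d : ℕ} (a b x : EuclideanSpace ℝ (Fin d)) (t : ℝ) :
    gaussDensity a x * Real.exp (t * ((‖x - a‖ ^ 2 - ‖x - b‖ ^ 2) / 2)) =
      Real.exp (-(t * (1 - t) * ‖a - b‖ ^ 2 / 2)) * gaussDensity (a + t • (b - a)) x := by
  have hb : x - b = (x - a) - (b - a) := by abel
  have hm : x - (a + t • (b - a)) = (x - a) - t • (b - a) := by abel
  unfold gaussDensity
  rw [mul_assoc, ← Real.exp_add, mul_left_comm (Real.exp (-(_))), ← Real.exp_add, hb, hm,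
    norm_sub_rev a b, norm_sub_sq_real (x - a) (b - a),
    norm_sub_sq_real (x - a) (t • (b - a)), norm_smul, inner_smul_right, mul_pow, Real.norm_eq_abs,
    sq_abs]
  ring_nf

theorem max_zero_le_exp_mul (s : ℝ) : max 0 s ≤ 8 / 3 * Real.exp (3 / 8 * s - 1) := by
  have := Real.add_one_le_exp (3 / 8 * s - 1)
  exact max_le (by positivity) (by linarith)

/-- The contribution of one component to the divergence, bounded below pointwise. -/
theorem gaussDensity_mul_log_ratio_ge {d : ℕ} (a b x : EuclideanSpace ℝ (Fin d))
    {w v tw tv : ℝ} (hw : 0 < w) (hv : 0 < v) (htw : 0 < tw) (htv : 0 < tv)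
    (htsum : tw + tv = 1) :
    gaussDensity a x * (Real.log w - Real.log (tw + Real.exp (-‖a - b‖ ^ 2 / 4))) -
        Real.exp (-‖a - b‖ ^ 2 / 64) * gaussDensity (a + (3 / 8 : ℝ) • (b - a)) x ≤
      gaussDensity a x * Real.log ((w * gaussDensity a x + v * gaussDensity b x) /
        (tw * gaussDensity a x + tv * gaussDensity b x)) := by
  set D := (‖x - a‖ ^ 2 - ‖x - b‖ ^ 2) / 2 with hD
  set c := Real.exp (-‖a - b‖ ^ 2 / 4) with hc
  have ha := gaussDensity_pos a x
  have hc0 : 0 < c := Real.exp_pos _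
  set s := D + ‖a - b‖ ^ 2 / 4 with hs
  set u := 8 / 3 * Real.exp (3 / 8 * s - 1) with hu
  have hratio : (w * gaussDensity a x + v * gaussDensity b x) /
      (tw * gaussDensity a x + tv * gaussDensity b x) =
      (w + v * Real.exp D) / (tw + tv * Real.exp D) := by
    rw [gaussDensity_eq_mul_exp a b x, ← hD]
    field_simp
  have hnum : Real.log w ≤ Real.log (w + v * Real.exp D) :=
    Real.log_le_log hw (le_add_of_nonneg_right (by positivity))
  have hden : Real.log (tw + tv * Real.exp D) ≤ Real.log (tw + c) + u := by
    obtain ⟨hu0, hsu⟩ := max_le_iff.1 (max_zero_le_exp_mul s)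
    have hDc : Real.exp D = c * Real.exp s := by
      rw [hc, ← Real.exp_add, hs]
      ring_nf
    have h1 : 1 ≤ Real.exp u := Real.one_le_exp hu0
    have h2 : Real.exp s ≤ Real.exp u := Real.exp_le_exp.2 hsu
    rw [← Real.log_exp u, ← Real.log_mul (by positivity) (by positivity)]
    refine Real.log_le_log (by positivity) ?_
    calc tw + tv * Real.exp D ≤ tw + 1 * Real.exp D := by gcongr; linarith
      _ = tw * 1 + c * Real.exp s := by rw [hDc]; ring
      _ ≤ tw * Real.exp u + c * Real.exp u := by gcongr
      _ = (tw + c) * Real.exp u := by ring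
  have herr : gaussDensity a x * u ≤
      Real.exp (-‖a - b‖ ^ 2 / 64) * gaussDensity (a + (3 / 8 : ℝ) • (b - a)) x := by
    have hsplit : Real.exp (3 / 8 * s - 1) =
        Real.exp (3 / 8 * D) * (Real.exp (3 / 32 * ‖a - b‖ ^ 2) * Real.exp (-1)) := by
      rw [← Real.exp_add, ← Real.exp_add, hs]
      ring_nf
    have he : 8 / 3 * Real.exp (-1) ≤ 1 := by
      rw [Real.exp_neg, ← div_eq_mul_inv, div_le_one (Real.exp_pos _)]
      linarith [Real.exp_one_gt_d9]
    have hm := gaussDensity_pos (a + (3 / 8 : ℝ) • (b - a)) x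
    calc gaussDensity a x * u
        = (gaussDensity a x * Real.exp (3 / 8 * D)) * Real.exp (3 / 32 * ‖a - b‖ ^ 2) *
            (8 / 3 * Real.exp (-1)) := by rw [hu, hsplit]; ring
      _ ≤ (gaussDensity a x * Real.exp (3 / 8 * D)) * Real.exp (3 / 32 * ‖a - b‖ ^ 2) * 1 := by
          gcongr
      _ = Real.exp (-(3 / 128) * ‖a - b‖ ^ 2) *
            gaussDensity (a + (3 / 8 : ℝ) • (b - a)) x := by
          rw [gaussDensity_mul_exp_mul, mul_one, mul_right_comm, ← Real.exp_add]
          ring_nf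
      _ ≤ _ := by
          gcongr
          linarith [sq_nonneg ‖a - b‖]
  rw [hratio, Real.log_div (by positivity) (by positivity)]
  have hmul := mul_le_mul_of_nonneg_left
    (show Real.log w - Real.log (tw + c) - u ≤
      Real.log (w + v * Real.exp D) - Real.log (tw + tv * Real.exp D) by linarith) ha.le
  linarith [hmul, mul_sub (gaussDensity a x) (Real.log w - Real.log (tw + c)) u]

theorem mixture_div_mixture_le {p q w v tw tv : ℝ} (hp : 0 < p) (hq : 0 < q) (hw : 0 < w)
    (hv : 0 < v) (htw : 0 < tw) (htv : 0 < tv) :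
    (w * p + v * q) / (tw * p + tv * q) ≤ w / tw + v / tv := by
  rw [div_le_iff₀ (by positivity)]
  have h : (w / tw + v / tv) * (tw * p + tv * q) =
      w * p + v * q + (w / tw * (tv * q) + v / tv * (tw * p)) := by
    field_simp
    ring
  rw [h]
  exact le_add_of_nonneg_right (by positivity)

theorem abs_log_mixture_div_mixture_le {p q w v tw tv : ℝ} (hp : 0 < p) (hq : 0 < q)
    (hw : 0 < w) (hv : 0 < v) (htw : 0 < tw) (htv : 0 < tv) :
    |Real.log ((w * p + v * q) / (tw * p + tv * q))| ≤
      (w / tw + v / tv) + (tw / w + tv / v) := by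
  have h1 := mixture_div_mixture_le hp hq hw hv htw htv
  have h2 := mixture_div_mixture_le hp hq htw htv hw hv
  have h3 := Real.log_le_self (show 0 ≤ (w * p + v * q) / (tw * p + tv * q) by positivity)
  have h4 := Real.log_le_self (show 0 ≤ (tw * p + tv * q) / (w * p + v * q) by positivity)
  have h5 : Real.log ((tw * p + tv * q) / (w * p + v * q)) =
      -Real.log ((w * p + v * q) / (tw * p + tv * q)) := by rw [← Real.log_inv, inv_div]
  have h6 : 0 < w / tw + v / tv := by positivity
  have h7 : 0 < tw / w + tv / v := by positivity
  rw [abs_le]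
  constructor <;> linarith

theorem integrable_mixture_mul_log_ratio {d : ℕ} (a b : EuclideanSpace ℝ (Fin d))
    {w v tw tv : ℝ} (hw : 0 < w) (hv : 0 < v) (htw : 0 < tw) (htv : 0 < tv) :
    Integrable fun x => (w * gaussDensity a x + v * gaussDensity b x) *
      Real.log ((w * gaussDensity a x + v * gaussDensity b x) /
        (tw * gaussDensity a x + tv * gaussDensity b x)) := by
  have ha := (continuous_gaussDensity a).measurable
  have hb := (continuous_gaussDensity b).measurable
  refine (((integrable_gaussDensity a).const_mul w).add
    ((integrable_gaussDensity b).const_mul v)).mul_bdd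
    (c := (w / tw + v / tv) + (tw / w + tv / v))
    (Measurable.aestronglyMeasurable (by fun_prop)) (.of_forall fun x => ?_)
  exact abs_log_mixture_div_mixture_le (gaussDensity_pos a x) (gaussDensity_pos b x) hw hv htw htv

/-- Lower bound on the KL divergence between two mixtures of Gaussians with the same
components but different weights. -/
theorem kl_lower_bound_mog {d : ℕ} (a₁ a₂ : EuclideanSpace ℝ (Fin d))
    (w₁ w₂ tw₁ tw₂ : ℝ) (hw₁ : 0 < w₁) (hw₂ : 0 < w₂) (htw₁ : 0 < tw₁) (htw₂ : 0 < tw₂)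
    (hsum : w₁ + w₂ = 1) (htsum : tw₁ + tw₂ = 1) :
    w₁ * (Real.log w₁ - Real.log (tw₁ + Real.exp (-‖a₁ - a₂‖ ^ 2 / 4))) +
      w₂ * (Real.log w₂ - Real.log (tw₂ + Real.exp (-‖a₁ - a₂‖ ^ 2 / 4))) -
      (Real.log 4 + d) * Real.exp ((d : ℝ) / 2 * Real.log 2 - ‖a₁ - a₂‖ ^ 2 / 64) ≤
    ∫ x, (w₁ * gaussDensity a₁ x + w₂ * gaussDensity a₂ x) *
        Real.log ((w₁ * gaussDensity a₁ x + w₂ * gaussDensity a₂ x) /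
          (tw₁ * gaussDensity a₁ x + tw₂ * gaussDensity a₂ x)) := by
  set r := ‖a₁ - a₂‖
  set C₁ := Real.log w₁ - Real.log (tw₁ + Real.exp (-r ^ 2 / 4)) with hC₁
  set C₂ := Real.log w₂ - Real.log (tw₂ + Real.exp (-r ^ 2 / 4)) with hC₂
  set ε := Real.exp (-r ^ 2 / 64)
  set m₁ := a₁ + (3 / 8 : ℝ) • (a₂ - a₁)
  set m₂ := a₂ + (3 / 8 : ℝ) • (a₁ - a₂)
  have hcoef : ε ≤ (Real.log 4 + d) * Real.exp ((d : ℝ) / 2 * Real.log 2 - r ^ 2 / 64) := by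
    have h4 : 1 ≤ Real.log 4 := by
      rw [Real.le_log_iff_exp_le (by norm_num)]
      linarith [Real.exp_one_lt_d9]
    have hd : (0 : ℝ) ≤ (d : ℝ) / 2 * Real.log 2 :=
      mul_nonneg (by positivity) (Real.log_nonneg (by norm_num))
    have hexp : ε ≤ Real.exp ((d : ℝ) / 2 * Real.log 2 - r ^ 2 / 64) :=
      Real.exp_le_exp.2 (by linarith)
    exact hexp.trans (le_mul_of_one_le_left (Real.exp_pos _).le
      (by linarith [(Nat.cast_nonneg d : (0 : ℝ) ≤ d)]))
  have hi : ∀ (a m : EuclideanSpace ℝ (Fin d)) (w C : ℝ),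
      Integrable fun x => w * (gaussDensity a x * C - ε * gaussDensity m x) := fun a m w C =>
    (((integrable_gaussDensity a).mul_const C).sub
      ((integrable_gaussDensity m).const_mul ε)).const_mul w
  have hint : ∀ (a m : EuclideanSpace ℝ (Fin d)) (w C : ℝ),
      ∫ x, w * (gaussDensity a x * C - ε * gaussDensity m x) = w * (C - ε) := fun a m w C => by
    rw [integral_const_mul, integral_sub ((integrable_gaussDensity a).mul_const C)
      ((integrable_gaussDensity m).const_mul ε), integral_mul_const, integral_const_mul,
      integral_gaussDensity, integral_gaussDensity, one_mul, mul_one]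
  calc w₁ * C₁ + w₂ * C₂ -
        (Real.log 4 + d) * Real.exp ((d : ℝ) / 2 * Real.log 2 - r ^ 2 / 64)
      ≤ w₁ * C₁ + w₂ * C₂ - (w₁ + w₂) * ε := by rw [hsum]; linarith
    _ = ∫ x, (w₁ * (gaussDensity a₁ x * C₁ - ε * gaussDensity m₁ x) +
          w₂ * (gaussDensity a₂ x * C₂ - ε * gaussDensity m₂ x)) := by
        rw [integral_add (hi _ _ _ _) (hi _ _ _ _), hint, hint]
        ring
    _ ≤ _ := by
        refine integral_mono ((hi _ _ _ _).add (hi _ _ _ _))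
          (integrable_mixture_mul_log_ratio a₁ a₂ hw₁ hw₂ htw₁ htw₂) fun x => ?_
        have h₁ := gaussDensity_mul_log_ratio_ge a₁ a₂ x hw₁ hw₂ htw₁ htw₂ htsum
        have h₂ := gaussDensity_mul_log_ratio_ge a₂ a₁ x hw₂ hw₁ htw₂ htw₁
          ((add_comm _ _).trans htsum)
        rw [norm_sub_rev a₂ a₁, add_comm (w₂ * _), add_comm (tw₂ * _)] at h₂
        have h₁' := mul_le_mul_of_nonneg_left h₁ hw₁.le
        have h₂' := mul_le_mul_of_nonneg_left h₂ hw₂.le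
        beta_reduce
        rw [add_mul, mul_assoc, mul_assoc]
        exact add_le_add h₁' h₂'
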